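/- arXiv:1705.00788 — 2 statements merged into one kernel-verified Lean document; each statement's English description precedes it below -/
import Mathlib

section
/- Let D be the Weyl algebra in one variable over k. There is no surjective homomorphism of left D-modules from D/(D·(X∘∂)) onto D/(D·X). In particular, the short exact sequence of left D-modules 0 → D/(D·X) → D/(D·(X∘∂)) → D/(D·∂) → 0 induced by right composition with ∂ does not split. -/
open Polynomial

set_option maxHeartbeats 1000000
set_option synthInstance.maxHeartbeats 400000

/-- Multiplication by `x` on `k[x]`, as a `k`-linear endomorphism. -/
noncomputable def Xop (k : Type) [Field k] : Module.End k (Polynomial k) :=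
  Algebra.lmul k (Polynomial k) Polynomial.X

/-- The derivative `∂ = d/dx` on `k[x]`, as a `k`-linear endomorphism. -/
noncomputable def Dop (k : Type) [Field k] : Module.End k (Polynomial k) :=
  Polynomial.derivative

/-- The Weyl algebra in one variable: the `k`-subalgebra of `End_k(k[x])` generated by
the multiplication operator `X` and the derivative operator `∂`. -/
noncomputable def Weyl1 (k : Type) [Field k] : Type :=
  Algebra.adjoin k {Xop k, Dop k}

noncomputable instance (k : Type) [Field k] : Ring (Weyl1 k) :=
  inferInstanceAs (Ring ↥(Algebra.adjoin k {Xop k, Dop k}))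

noncomputable instance (k : Type) [Field k] : Algebra k (Weyl1 k) :=
  inferInstanceAs (Algebra k ↥(Algebra.adjoin k {Xop k, Dop k}))

/-- `X` as an element of the Weyl algebra. -/
noncomputable def XD (k : Type) [Field k] : Weyl1 k :=
  (⟨Xop k, Algebra.subset_adjoin (Set.mem_insert _ _)⟩ :
    ↥(Algebra.adjoin k {Xop k, Dop k}))

/-- `∂` as an element of the Weyl algebra. -/
noncomputable def dD (k : Type) [Field k] : Weyl1 k :=
  (⟨Dop k, Algebra.subset_adjoin (Set.mem_insert_of_mem _ rfl)⟩ :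
    ↥(Algebra.adjoin k {Xop k, Dop k}))
namespace Weyl1

/-- The tautological representation of the Weyl algebra on `k[x]`. -/
noncomputable def toEnd (k : Type) [Field k] : Weyl1 k →ₐ[k] Module.End k k[X] :=
  (Algebra.adjoin k {Xop k, Dop k}).val

variable {k : Type} [Field k]

theorem toEnd_injective : Function.Injective (toEnd k) :=
  Subtype.val_injective

@[simp]
theorem toEnd_XD (f : k[X]) : toEnd k (XD k) f = Polynomial.X * f :=
  rfl

@[simp]
theorem toEnd_dD (f : k[X]) : toEnd k (dD k) f = derivative f :=
  rfl

theorem dD_mul_XD : dD k * XD k = XD k * dD k + 1 := by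
  apply toEnd_injective
  refine LinearMap.ext fun f ↦ ?_
  simp [add_comm]

theorem dD_mul_XD_pow (n : ℕ) :
    dD k * XD k ^ (n + 1) = XD k ^ (n + 1) * dD k + (n + 1) * XD k ^ n := by
  induction n with
  | zero => simp [dD_mul_XD]
  | succ n ih =>
    have hc : (n : Weyl1 k) * XD k = XD k * n := Nat.cast_comm n _
    rw [pow_succ (XD k) (n + 1), ← mul_assoc, ih, add_mul, mul_assoc _ (dD k), dD_mul_XD,
      mul_assoc _ _ (XD k), ← pow_succ]
    push_cast
    noncomm_ring

theorem induction {C : Weyl1 k → Prop} (algebraMap : ∀ c : k, C (algebraMap k (Weyl1 k) c))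
    (XD : C (XD k)) (dD : C (dD k)) (add : ∀ a b, C a → C b → C (a + b))
    (mul : ∀ a b, C a → C b → C (a * b)) (δ : Weyl1 k) : C δ := by
  obtain ⟨δ, hδ⟩ := δ
  induction hδ using Algebra.adjoin_induction with
  | mem x hx =>
    rcases hx with rfl | rfl
    exacts [XD, dD]
  | algebraMap c => exact algebraMap c
  | add a b ha hb iha ihb => exact add _ _ iha ihb
  | mul a b ha hb iha ihb => exact mul _ _ iha ihb

section Torsion

variable {M : Type*} [AddCommGroup M] [Module (Weyl1 k) M]

theorem XD_pow_smul_eq_zero_of_le {v : M} {m n : ℕ} (hmn : m ≤ n) (hv : XD k ^ m • v = 0) :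
    XD k ^ n • v = 0 := by
  rw [← Nat.sub_add_cancel hmn, pow_add, mul_smul, hv, smul_zero]

/-- The `X`-power torsion of a `D`-module is stable under `D`. -/
theorem exists_XD_pow_smul_smul_eq_zero (δ : Weyl1 k) :
    ∀ v : M, (∃ n, XD k ^ n • v = 0) → ∃ n, XD k ^ n • δ • v = 0 := by
  induction δ using induction with
  | algebraMap c =>
    rintro v ⟨n, hn⟩
    refine ⟨n, ?_⟩
    rw [← mul_smul, ← Algebra.commutes, mul_smul, hn, smul_zero]
  | XD =>
    rintro v ⟨n, hn⟩
    refine ⟨n, ?_⟩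
    rw [← mul_smul, ← pow_succ, pow_succ', mul_smul, hn, smul_zero]
  | dD =>
    rintro v ⟨n, hn⟩
    refine ⟨n + 1, ?_⟩
    rw [← mul_smul, eq_sub_iff_add_eq.mpr (dD_mul_XD_pow n).symm, sub_smul, mul_smul, mul_smul,
      hn, XD_pow_smul_eq_zero_of_le n.le_succ hn, smul_zero, smul_zero, sub_zero]
  | add a b ha hb =>
    intro v hv
    obtain ⟨m, hm⟩ := ha v hv
    obtain ⟨n, hn⟩ := hb v hv
    refine ⟨max m n, ?_⟩
    rw [add_smul, smul_add, XD_pow_smul_eq_zero_of_le (le_max_left m n) hm,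
      XD_pow_smul_eq_zero_of_le (le_max_right m n) hn, add_zero]
  | mul a b ha hb =>
    intro v hv
    rw [mul_smul]
    exact ha _ (hb v hv)

/-- In characteristic zero, `X∂` is injective on `X`-power torsion. -/
theorem eq_zero_of_XD_mul_dD_smul_eq_zero [CharZero k] {v : M}
    (hv : (XD k * dD k) • v = 0) (n : ℕ) (hn : XD k ^ n • v = 0) : v = 0 := by
  induction n with
  | zero => simpa using hn
  | succ n ih =>
    apply ih
    have h := congrArg (· • v) (dD_mul_XD_pow (k := k) n)
    simp only [add_smul, mul_smul, hn, smul_zero] at h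
    rw [pow_succ, mul_smul, ← mul_smul (XD k), hv, smul_zero, zero_add] at h
    have hu : algebraMap k (Weyl1 k) (n + 1 : k)⁻¹ * (n + 1) = 1 := by
      have h1 : (n + 1 : Weyl1 k) = algebraMap k (Weyl1 k) (n + 1) := by simp
      rw [h1, ← map_mul, inv_mul_cancel₀ n.cast_add_one_ne_zero, map_one]
    rw [← one_smul (Weyl1 k) (XD k ^ n • v), ← hu, mul_smul, add_smul, ← h, smul_zero]

end Torsion

/-- Elements of the Weyl algebra are continuous for the `(1 - x)`-adic topology on `k[x]`. -/
theorem exists_pow_dvd_toEnd (δ : Weyl1 k) :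
    ∀ m : ℕ, ∃ n : ℕ, ∀ f : k[X],
      (1 - Polynomial.X) ^ n ∣ f → (1 - Polynomial.X) ^ m ∣ toEnd k δ f := by
  induction δ using induction with
  | algebraMap c =>
    refine fun m ↦ ⟨m, fun f hf ↦ ?_⟩
    rw [AlgHom.commutes, Module.algebraMap_end_apply]
    exact dvd_smul_of_dvd c hf
  | XD => exact fun m ↦ ⟨m, fun f hf ↦ hf.mul_left _⟩
  | dD =>
    exact fun m ↦ ⟨m + 1, fun f hf ↦ by
      simpa using pow_sub_one_dvd_derivative_of_pow_dvd hf⟩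
  | add a b ha hb =>
    intro m
    obtain ⟨p, hp⟩ := ha m
    obtain ⟨q, hq⟩ := hb m
    refine ⟨max p q, fun f hf ↦ ?_⟩
    rw [map_add, LinearMap.add_apply]
    exact dvd_add (hp f ((pow_dvd_pow _ (le_max_left p q)).trans hf))
      (hq f ((pow_dvd_pow _ (le_max_right p q)).trans hf))
  | mul a b ha hb =>
    intro m
    obtain ⟨p, hp⟩ := ha m
    obtain ⟨q, hq⟩ := hb p
    refine ⟨q, fun f hf ↦ ?_⟩
    rw [map_mul, Module.End.mul_apply]
    exact hp _ (hq f hf)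

theorem mul_XD_ne_one (δ : Weyl1 k) : δ * XD k ≠ 1 := by
  intro h
  have hδ (f : k[X]) : toEnd k δ (Polynomial.X * f) = f := by
    simpa using congrArg (toEnd k · f) h
  set p := Polynomial.X * toEnd k δ 1 - 1 with hp
  have hdeg : (1 - Polynomial.X : k[X]).natDegree = 1 := by
    rw [← natDegree_neg, neg_sub, ← C_1, natDegree_X_sub_C]
  have hdvd : (1 - Polynomial.X) ^ (p.natDegree + 1) ∣ p := by
    obtain ⟨n, hn⟩ := exists_pow_dvd_toEnd δ (p.natDegree + 1)
    set N := max n (p.natDegree + 1)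
    obtain ⟨g, hg⟩ : Polynomial.X ∣ 1 - (1 - Polynomial.X : k[X]) ^ N := by
      simp [X_dvd_iff, coeff_zero_eq_eval_zero]
    have h1 : toEnd k δ 1 = toEnd k δ ((1 - Polynomial.X) ^ N) + g := by
      rw [← sub_eq_iff_eq_add', ← map_sub, hg, hδ]
    have h2 : p = Polynomial.X * toEnd k δ ((1 - Polynomial.X) ^ N)
        - (1 - Polynomial.X) ^ N := by
      rw [hp, h1]
      linear_combination -hg
    have hN : p.natDegree + 1 ≤ N := le_max_right _ _
    conv_rhs => rw [h2]
    exact dvd_sub ((hn _ (pow_dvd_pow _ (le_max_left _ _))).mul_left _)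
      (pow_dvd_pow _ hN)
  have hp0 : p = 0 := eq_zero_of_dvd_of_natDegree_lt hdvd (by simp [natDegree_pow, hdeg])
  simpa [hp] using congrArg (eval 0) hp0

/-- In characteristic zero, `D/(D·(X∂))` does not surject onto `D/(D·X)`. -/
theorem not_surjective_quotient_XD [CharZero k]
    (φ : (Weyl1 k ⧸ (Submodule.span (Weyl1 k) {XD k * dD k})) →ₗ[Weyl1 k]
      (Weyl1 k ⧸ (Submodule.span (Weyl1 k) {XD k}))) : ¬ Function.Surjective φ := by
  intro hφ
  have mk_eq_smul (I : Submodule (Weyl1 k) (Weyl1 k)) (δ : Weyl1 k) :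
      (Submodule.Quotient.mk δ : Weyl1 k ⧸ I) = δ • Submodule.Quotient.mk 1 := by
    rw [← Submodule.Quotient.mk_smul, smul_eq_mul, mul_one]
  have hgen : φ (Submodule.Quotient.mk 1) = 0 := by
    obtain ⟨δ, hδ⟩ := Submodule.Quotient.mk_surjective _ (φ (Submodule.Quotient.mk 1))
    obtain ⟨n, hn⟩ := exists_XD_pow_smul_smul_eq_zero δ
      (Submodule.Quotient.mk 1 : Weyl1 k ⧸ Submodule.span (Weyl1 k) {XD k})
      ⟨1, by
        rw [pow_one, ← mk_eq_smul, Submodule.Quotient.mk_eq_zero]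
        exact Submodule.mem_span_singleton_self _⟩
    rw [← mk_eq_smul, hδ] at hn
    refine eq_zero_of_XD_mul_dD_smul_eq_zero ?_ n hn
    rw [← map_smul, ← mk_eq_smul,
      (Submodule.Quotient.mk_eq_zero _).mpr (Submodule.mem_span_singleton_self _), map_zero]
  obtain ⟨w, hw⟩ := hφ (Submodule.Quotient.mk 1)
  obtain ⟨δ, rfl⟩ := Submodule.Quotient.mk_surjective _ w
  rw [mk_eq_smul, map_smul, hgen, smul_zero, eq_comm, Submodule.Quotient.mk_eq_zero,
    Submodule.mem_span_singleton] at hw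
  obtain ⟨γ, hγ⟩ := hw
  exact mul_XD_ne_one γ hγ

end Weyl1

/-- Let `D` be the Weyl algebra in one variable over a field `k` of
characteristic zero.  There is no surjective homomorphism of left `D`-modules from
`D/(D·(X∘∂))` onto `D/(D·X)` (the latter being isomorphic to `E = H^1_{(x)}(k[x])`);
in particular, the short exact sequence `0 → D/(D·X) → D/(D·(X∘∂)) → D/(D·∂) → 0`
induced by right composition with `∂` does not split. -/
theorem no_surjection_from_D_mod_xd_onto_D_mod_X (k : Type) [Field k] [CharZero k] :
    (¬ ∃ φ : (Weyl1 k ⧸ (Submodule.span (Weyl1 k) {XD k * dD k})) →ₗ[Weyl1 k]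
          (Weyl1 k ⧸ (Submodule.span (Weyl1 k) {XD k})),
        Function.Surjective φ) ∧
    (∀ f : (Weyl1 k ⧸ (Submodule.span (Weyl1 k) {XD k})) →ₗ[Weyl1 k]
          (Weyl1 k ⧸ (Submodule.span (Weyl1 k) {XD k * dD k})),
      (∀ δ : Weyl1 k, f (Submodule.Quotient.mk δ) = Submodule.Quotient.mk (δ * dD k)) →
      ¬ ∃ r : (Weyl1 k ⧸ (Submodule.span (Weyl1 k) {XD k * dD k})) →ₗ[Weyl1 k]
            (Weyl1 k ⧸ (Submodule.span (Weyl1 k) {XD k})),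
          r.comp f = LinearMap.id) := by
  exact ⟨fun ⟨φ, hφ⟩ ↦ Weyl1.not_surjective_quotient_XD φ hφ, fun f _ ⟨r, hr⟩ ↦
    Weyl1.not_surjective_quotient_XD r fun w ↦ ⟨f w, LinearMap.congr_fun hr w⟩⟩
end

section
/- Let n ≥ 2 and let M = R_{x_1}/R be the cokernel of the localization map R → R_{x_1}, viewed as a ℤ-graded R-module. Then every homogeneous prime ideal p of R with x_1 ∉ p is an associated prime of the R-module DD(M); in particular, DD(M) has infinitely many associated primes. -/
/-!
Statement 16: for `n ≥ 2` and `M = R_{x₁}/R` over `R = k[x₁,…,xₙ]`, every homogeneous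
prime `p` with `x₁ ∉ p` is an associated prime of the graded Matlis dual `DD(M)`;
in particular `DD(M)` has infinitely many associated primes.
-/

open MvPolynomial
open scoped DirectSum

set_option maxHeartbeats 2000000
set_option synthInstance.maxHeartbeats 1000000

section MatlisDual

variable {k : Type} [Field k] {n : ℕ} {M : Type} [AddCommGroup M] [Module k M]

/-- The carrier of the graded Matlis dual `DD(M)`, with `DD(M)_l = Hom_k(M_{-l-n}, k)`. -/
abbrev DDcar (deg : ℤ → Submodule k M) (n : ℕ) : Type :=
  @DirectSum ℤ (fun l => Module.Dual k ↥(deg (-l - (n : ℤ))))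
    (fun l => (inferInstance :
      AddCommGroup (Module.Dual k ↥(deg (-l - (n : ℤ))))).toAddCommMonoid)

/-- Projection of `M` onto its degree-`l` component. -/
noncomputable def gproj (deg : ℤ → Submodule k M) (hint : DirectSum.IsInternal deg) (l : ℤ) :
    M →ₗ[k] ↥(deg l) :=
  (DirectSum.component k ℤ (fun j => ↥(deg j)) l).comp
    (LinearEquiv.ofBijective (DirectSum.coeLinearMap deg) hint).symm.toLinearMap

/-- The evaluation pairing `⟨λ, m⟩ = Σ_l λ_l(m_{-l-n})` between `DD(M)` and `M`
(injective in the first variable, hence characterizing the `R`-action uniquely). -/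
noncomputable def gev (deg : ℤ → Submodule k M) (hint : DirectSum.IsInternal deg) :
    DDcar deg n →ₗ[k] Module.Dual k M :=
  DirectSum.toModule k ℤ (Module.Dual k M)
    (fun l => (gproj deg hint (-l - (n : ℤ))).dualMap)

end MatlisDual

theorem eq_of_add_two_pow_eq {D j x y : ℕ} (hx : x ≤ D) (hy : y ≤ D)
    (h : x + 2 ^ (D + 1) = y + 2 ^ j) : x = y := by
  have h1 : D < 2 ^ D := Nat.lt_two_pow_self
  rcases lt_trichotomy j (D + 1) with h2 | rfl | h2
  · have := Nat.pow_le_pow_right (n := 2) (by norm_num) (Nat.le_of_lt_succ h2)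
    rw [pow_succ] at h
    omega
  · omega
  · have := Nat.pow_le_pow_right (n := 2) (by norm_num) h2
    rw [pow_succ] at h this
    rw [pow_succ] at this
    omega

/-- A linear functional on a polynomial ring whose kernel contains no nonzero ideal. -/
theorem MvPolynomial.exists_dual_forall_ne_zero (k σ : Type*) [Field k] [Finite σ] :
    ∃ μ : Module.Dual k (MvPolynomial σ k),
      ∀ f : MvPolynomial σ k, f ≠ 0 → ∃ g, μ (f * g) ≠ 0 := by
  classical
  let c : (σ →₀ ℕ) → k := fun a => if ∃ j : ℕ, ∀ i, a i = 2 ^ j then 1 else 0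
  refine ⟨(basisMonomials σ k).constr k c, fun f hf => ?_⟩
  obtain ⟨a₀, ha₀⟩ := support_nonempty.mpr hf
  let D := f.totalDegree
  have hD : ∀ a ∈ f.support, ∀ i, a i ≤ D := fun a ha i =>
    (Finsupp.le_degree i a).trans (le_totalDegree ha)
  let m : σ →₀ ℕ := Finsupp.equivFunOnFinite.symm fun i => 2 ^ (D + 1) - a₀ i
  have hm : ∀ i, m i + a₀ i = 2 ^ (D + 1) := fun i => by
    have h1 : D + 1 < 2 ^ (D + 1) := Nat.lt_two_pow_self
    have h2 := hD a₀ ha₀ i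
    change 2 ^ (D + 1) - a₀ i + a₀ i = _
    omega
  refine ⟨monomial m 1, ?_⟩
  have key : (basisMonomials σ k).constr k c (f * monomial m 1) =
      ∑ a ∈ f.support, coeff a f * c (a + m) := by
    conv_lhs => rw [f.as_sum]
    rw [Finset.sum_mul, map_sum]
    refine Finset.sum_congr rfl fun a _ => ?_
    rw [monomial_mul, mul_one, ← mul_one (coeff a f), ← smul_eq_mul, ← smul_monomial, map_smul,
      smul_eq_mul, smul_eq_mul, mul_one]
    congr 1
    simpa using (basisMonomials σ k).constr_basis k c (a + m)
  rw [key, Finset.sum_eq_single_of_mem a₀ ha₀]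
  · have : c (a₀ + m) = 1 := if_pos ⟨D + 1, fun i => by rw [← hm i]; simp [add_comm]⟩
    rw [this, mul_one]
    exact mem_support_iff.mp ha₀
  · intro a ha hne
    have : c (a + m) = 0 := if_neg fun ⟨j, hj⟩ => hne <| by
      ext i
      refine eq_of_add_two_pow_eq (j := j) (hD a ha i) (hD a₀ ha₀ i) ?_
      rw [← hj i, ← hm i, Finsupp.add_apply]
      omega
    rw [this, mul_zero]

/-- A finitely generated domain over a field has a linear functional whose kernel contains no
nonzero ideal. -/
theorem exists_dual_forall_ne_zero (k B : Type*) [Field k] [CommRing B] [IsDomain B] [Algebra k B]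
    [Algebra.FiniteType k B] :
    ∃ μ : Module.Dual k B, ∀ b : B, b ≠ 0 → ∃ c, μ (b * c) ≠ 0 := by
  obtain ⟨s, g, hg, hint⟩ := exists_integral_inj_algHom_of_fg k B
  obtain ⟨μ, hμ⟩ := MvPolynomial.exists_dual_forall_ne_zero k (Fin s)
  obtain ⟨h, hh⟩ := LinearMap.exists_leftInverse_of_injective g.toLinearMap
    (LinearMap.ker_eq_bot.mpr hg)
  refine ⟨μ ∘ₗ h, fun b hb => ?_⟩
  algebraize [g.toRingHom]
  have hne : (Ideal.span {b}).comap (algebraMap (MvPolynomial (Fin s) k) B) ≠ ⊥ :=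
    Ideal.comap_ne_bot_of_integral_mem hb (Ideal.mem_span_singleton_self b) (hint b)
  obtain ⟨f, hf, hf0⟩ := Submodule.exists_mem_ne_zero_of_ne_bot hne
  obtain ⟨c, hc⟩ := Ideal.mem_span_singleton'.mp (Ideal.mem_comap.mp hf)
  obtain ⟨r, hr⟩ := hμ f hf0
  refine ⟨c * g r, ?_⟩
  have : b * (c * g r) = g.toLinearMap (f * r) := by
    rw [← mul_assoc, mul_comm b c, hc]
    exact (map_mul g f r).symm
  rw [this, LinearMap.comp_apply, ← LinearMap.comp_apply h, hh]
  exact hr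

theorem MvPolynomial.IsHomogeneous.aeval_const_mul {k σ A : Type*} [CommRing k] [CommRing A]
    [Algebra k A] {f : MvPolynomial σ k} {d : ℕ} (hf : IsHomogeneous f d) (r : A) (y : σ → A) :
    MvPolynomial.aeval (fun i => r * y i) f = r ^ d * MvPolynomial.aeval y f := by
  rw [MvPolynomial.aeval_def, MvPolynomial.aeval_def, eval₂_eq, eval₂_eq, Finset.mul_sum]
  refine Finset.sum_congr rfl fun a ha => ?_
  have : ∏ i ∈ a.support, (r * y i) ^ a i = r ^ d * ∏ i ∈ a.support, y i ^ a i := by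
    rw [hf.degree_eq_sum_deg_support ha, ← Finset.prod_pow_eq_pow_sum, ← Finset.prod_mul_distrib]
    exact Finset.prod_congr rfl fun i _ => mul_pow _ _ _
  rw [this]
  ring

/-- Dehomogenization of the quotient by a prime `p` at a variable outside `p`. -/
theorem exists_dehomogenization {k σ : Type} [Field k] [Finite σ] (p : Ideal (MvPolynomial σ k))
    [p.IsPrime] (i₀ : σ) (hi₀ : (X i₀ : MvPolynomial σ k) ∉ p) :
    ∃ φ : MvPolynomial σ k →ₐ[k] FractionRing (MvPolynomial σ k ⧸ p),
      φ (X i₀) = 1 ∧ ∀ d f, f.IsHomogeneous d → (φ f = 0 ↔ f ∈ p) := by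
  let K := FractionRing (MvPolynomial σ k ⧸ p)
  let π : MvPolynomial σ k →ₐ[k] K :=
    (IsScalarTower.toAlgHom k (MvPolynomial σ k ⧸ p) K).comp (Ideal.Quotient.mkₐ k p)
  have hπ : ∀ f, π f = 0 ↔ f ∈ p := fun f => by
    rw [← Ideal.Quotient.eq_zero_iff_mem]
    exact (injective_iff_map_eq_zero' (algebraMap (MvPolynomial σ k ⧸ p) K)).mp
      (IsFractionRing.injective _ _) _
  have h0 : π (X i₀) ≠ 0 := fun h => hi₀ ((hπ _).mp h)
  refine ⟨aeval fun i => (π (X i₀))⁻¹ * π (X i), by rw [aeval_X, inv_mul_cancel₀ h0], fun d f hf => ?_⟩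
  rw [IsHomogeneous.aeval_const_mul hf, ← hπ f]
  have : aeval (fun i => π (X i)) f = π f := DFunLike.congr_fun (aeval_unique π).symm f
  rw [this, mul_eq_zero, or_iff_right (pow_ne_zero _ (inv_ne_zero h0))]

theorem exists_dual_comp_ne_zero {k σ K : Type} [Field k] [Finite σ] [Field K] [Algebra k K]
    (φ : MvPolynomial σ k →ₐ[k] K) :
    ∃ μ : Module.Dual k K, ∀ f, φ f ≠ 0 → ∃ a, μ (φ f * φ (monomial a 1)) ≠ 0 := by
  have : Algebra.FiniteType k φ.range :=
    Algebra.FiniteType.of_surjective φ.rangeRestrict φ.rangeRestrict_surjective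
  obtain ⟨μ₀, hμ₀⟩ := exists_dual_forall_ne_zero k φ.range
  obtain ⟨μ, hμ⟩ := LinearMap.exists_extend (p := Subalgebra.toSubmodule φ.range) μ₀
  refine ⟨μ, fun f hf => ?_⟩
  obtain ⟨⟨_, g, rfl⟩, hc⟩ := hμ₀ (φ.rangeRestrict f) (fun h => hf (congrArg Subtype.val h))
  by_contra! h
  refine hc ?_
  rw [← hμ]
  change μ (φ f * φ g) = 0
  rw [g.as_sum, map_sum, Finset.mul_sum, map_sum]
  refine Finset.sum_eq_zero fun a _ => ?_
  have : monomial a (coeff a g) = coeff a g • monomial a (1 : k) := by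
    rw [smul_monomial, smul_eq_mul, mul_one]
  rw [this, map_smul, mul_smul_comm, map_smul, h a, smul_zero]

section MatlisDual

variable {k : Type} [Field k] {n : ℕ} {M : Type} [AddCommGroup M] [Module k M]

theorem gproj_of_mem {deg : ℤ → Submodule k M} (hint : DirectSum.IsInternal deg) {l : ℤ} {m : M}
    (hm : m ∈ deg l) : (gproj deg hint l m : M) = m := by
  have h := DirectSum.IsInternal.ofBijective_coeLinearMap_same hint ⟨m, hm⟩
  exact congrArg Subtype.val h

theorem gproj_of_mem_ne {deg : ℤ → Submodule k M} (hint : DirectSum.IsInternal deg) {l s : ℤ}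
    (hs : s ≠ l) {m : M} (hm : m ∈ deg s) : gproj deg hint l m = 0 :=
  DirectSum.IsInternal.ofBijective_coeLinearMap_of_ne hint hs ⟨m, hm⟩

theorem gev_of {deg : ℤ → Submodule k M} (hint : DirectSum.IsInternal deg) (l : ℤ)
    (ξ : Module.Dual k (deg (-l - (n : ℤ)))) (m : M) :
    gev (n := n) deg hint
      (DirectSum.of (fun l : ℤ => Module.Dual k (deg (-l - (n : ℤ)))) l ξ) m =
      ξ (gproj deg hint (-l - n) m) := by
  have := DirectSum.toModule_lof k (M := fun l : ℤ => Module.Dual k (deg (-l - (n : ℤ))))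
    (φ := fun l : ℤ => (gproj deg hint (-l - (n : ℤ))).dualMap) l ξ
  exact DFunLike.congr_fun this m

theorem gev_apply_coe {deg : ℤ → Submodule k M} (hint : DirectSum.IsInternal deg)
    (x : DDcar deg n) (l : ℤ) (m : deg (-l - (n : ℤ))) :
    gev deg hint x m = x l m := by
  induction x using DirectSum.induction_on with
  | zero => simp
  | add x y hx hy => simp [hx, hy]
  | of s ξ =>
    refine (gev_of hint s ξ m).trans ?_
    by_cases hs : s = l
    · subst hs
      rw [DirectSum.of_eq_same]
      exact congrArg ξ (Subtype.ext (gproj_of_mem hint m.2))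
    · rw [DirectSum.of_eq_of_ne _ _ _ (Ne.symm hs), gproj_of_mem_ne hint (by omega) m.2]
      simp

theorem gev_injective {deg : ℤ → Submodule k M} (hint : DirectSum.IsInternal deg) :
    Function.Injective (gev (n := n) deg hint) := by
  rw [injective_iff_map_eq_zero]
  intro x hx
  refine DFinsupp.ext fun l => LinearMap.ext fun m => ?_
  rw [← gev_apply_coe hint x l m, hx]
  rfl

/-- A functional concentrated in one degree comes from an element of the graded dual. -/
theorem exists_gev_eq {deg : ℤ → Submodule k M} (hint : DirectSum.IsInternal deg) (l : ℤ)
    (Λ : Module.Dual k M) {S : Set M} (hS : Submodule.span k S = ⊤)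
    (h : ∀ m ∈ S, ∃ s, m ∈ deg s ∧ (s ≠ -l - (n : ℤ) → Λ m = 0)) :
    ∃ lam : DDcar deg n, gev deg hint lam = Λ := by
  refine ⟨DirectSum.of (fun l : ℤ => Module.Dual k (deg (-l - (n : ℤ)))) l
    (Λ ∘ₗ (deg (-l - (n : ℤ))).subtype), LinearMap.ext_on hS fun m hm => ?_⟩
  obtain ⟨s, hs, h0⟩ := h m hm
  refine (gev_of hint l _ m).trans ?_
  by_cases hsl : s = -l - (n : ℤ)
  · subst hsl
    exact congrArg Λ (gproj_of_mem hint hs)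
  · rw [gproj_of_mem_ne hint hsl hs, h0 hsl, map_zero]

end MatlisDual

section LocalizationQuotient

variable {k σ : Type} [Field k] (i₀ : σ)

/-- The class of `f / x ^ j` in `R_x / R`, where `x = X i₀`. -/
noncomputable def fracClass (f : MvPolynomial σ k) (j : ℕ) :
    Localization.Away (X i₀ : MvPolynomial σ k) ⧸
      LinearMap.range (Algebra.linearMap (MvPolynomial σ k)
        (Localization.Away (X i₀ : MvPolynomial σ k))) :=
  Submodule.Quotient.mk (algebraMap (MvPolynomial σ k) (Localization.Away (X i₀)) f *
    (IsLocalization.Away.invSelf (X i₀ : MvPolynomial σ k)) ^ j)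

theorem smul_fracClass (f g : MvPolynomial σ k) (j : ℕ) :
    f • fracClass i₀ g j = fracClass i₀ (f * g) j := by
  rw [fracClass, fracClass, ← Submodule.Quotient.mk_smul, Algebra.smul_def, map_mul, mul_assoc]

theorem fracClass_sum {ι : Type*} (s : Finset ι) (f : ι → MvPolynomial σ k) (j : ℕ) :
    fracClass i₀ (∑ i ∈ s, f i) j = ∑ i ∈ s, fracClass i₀ (f i) j := by
  have h := fun g : MvPolynomial σ k => smul_fracClass i₀ g 1 j
  simp only [mul_one] at h
  rw [← h, Finset.sum_smul]
  exact Finset.sum_congr rfl fun i _ => h (f i)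

theorem span_fracClass_monomial :
    Submodule.span k {m | ∃ (a : σ →₀ ℕ) (j : ℕ), m = fracClass (k := k) i₀ (monomial a 1) j} =
      ⊤ := by
  rw [eq_top_iff]
  rintro m -
  obtain ⟨z, rfl⟩ := Submodule.Quotient.mk_surjective _ m
  obtain ⟨j, f, hz⟩ := IsLocalization.Away.surj (X i₀ : MvPolynomial σ k) z
  have hz' : Submodule.Quotient.mk z = fracClass i₀ f j := by
    rw [fracClass, ← hz, mul_assoc, ← mul_pow, IsLocalization.Away.mul_invSelf, one_pow, mul_one]
  rw [hz', f.as_sum, fracClass_sum]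
  refine Submodule.sum_mem _ fun a _ => ?_
  have : fracClass i₀ (monomial a (coeff a f)) j =
      coeff a f • fracClass (k := k) i₀ (monomial a 1) j := by
    rw [← algebraMap_smul (MvPolynomial σ k) (coeff a f), smul_fracClass, algebraMap_eq,
      C_mul_monomial, mul_one]
  rw [this]
  exact Submodule.smul_mem _ _ (Submodule.subset_span ⟨a, j, rfl⟩)

open LaurentPolynomial in
/-- A functional `μ` on the dehomogenization induces a functional on `R_x / R` that is concentrated
in degree `-1`. -/
theorem exists_dual_fracClass {A : Type} [CommRing A] [Algebra k A] (φ : MvPolynomial σ k →ₐ[k] A)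
    (hφ : φ (X i₀) = 1) (μ : Module.Dual k A) :
    ∃ Λ : Module.Dual k (Localization.Away (X i₀ : MvPolynomial σ k) ⧸
      LinearMap.range (Algebra.linearMap (MvPolynomial σ k)
        (Localization.Away (X i₀ : MvPolynomial σ k)))),
      ∀ (e : ℕ) (g : MvPolynomial σ k), g.IsHomogeneous e → ∀ j : ℕ,
        Λ (fracClass i₀ g j) = if e + 1 = j then μ (φ g) else 0 := by
  let θ : MvPolynomial σ k →ₐ[k] A[T;T⁻¹] :=
    aeval fun i => T 1 * algebraMap A A[T;T⁻¹] (φ (X i))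
  have hθ : ∀ (e : ℕ) (g : MvPolynomial σ k), g.IsHomogeneous e →
      θ g = .single (e : ℤ) (φ g) := fun e g hg => by
    have h1 : aeval (fun i => algebraMap A A[T;T⁻¹] (φ (X i))) g =
        algebraMap A A[T;T⁻¹] (φ g) := by
      have := DFunLike.congr_fun
        (aeval_unique ((IsScalarTower.toAlgHom k A A[T;T⁻¹]).comp φ)) g
      exact this.symm
    rw [single_eq_C_mul_T, LaurentPolynomial.C_eq_algebraMap, mul_comm]
    refine (IsHomogeneous.aeval_const_mul hg _ _).trans ?_
    rw [h1, T_pow, mul_one]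
  have hX : θ (X i₀) = T 1 := by
    rw [hθ 1 _ (isHomogeneous_X k i₀), hφ]; rfl
  have hu : IsUnit (θ (X i₀)) := hX ▸ isUnit_T 1
  let Θ : Localization.Away (X i₀ : MvPolynomial σ k) →ₐ[k] A[T;T⁻¹] :=
    IsLocalization.Away.liftAlgHom (X i₀ : MvPolynomial σ k) (f := θ) hu
  have hΘ : ∀ f, Θ (algebraMap _ _ f) = θ f := fun f =>
    IsLocalization.Away.lift_eq (X i₀ : MvPolynomial σ k) (g := θ.toRingHom) hu f
  have hinv : Θ (IsLocalization.Away.invSelf (X i₀ : MvPolynomial σ k)) = T (-1) := by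
    have h := congrArg Θ (IsLocalization.Away.mul_invSelf
      (S := Localization.Away (X i₀ : MvPolynomial σ k)) (X i₀ : MvPolynomial σ k))
    rw [map_mul, hΘ, hX, map_one] at h
    calc _ = T (-1) * (T 1 * Θ (IsLocalization.Away.invSelf (X i₀ : MvPolynomial σ k))) := by
          rw [← mul_assoc, ← T_add]; simp
      _ = _ := by rw [h, mul_one]
  let c : A[T;T⁻¹] →ₗ[k] A :=
    { toFun := fun z => z.coeff (-1)
      map_add' := fun _ _ => rfl
      map_smul' := fun _ _ => rfl }
  have hc : ∀ (s : ℤ) (x : A), c (.single s x) = if s = -1 then x else 0 := fun s x => by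
    change (Finsupp.single s x) (-1) = _
    exact Finsupp.single_apply
  let Λ₀ : Localization.Away (X i₀ : MvPolynomial σ k) →ₗ[k] k := μ ∘ₗ c ∘ₗ Θ.toLinearMap
  have hΛ₀ : ∀ (e : ℕ) (g : MvPolynomial σ k), g.IsHomogeneous e → ∀ j : ℕ,
      Λ₀ (algebraMap _ _ g * (IsLocalization.Away.invSelf (X i₀ : MvPolynomial σ k)) ^ j) =
        if e + 1 = j then μ (φ g) else 0 := fun e g hg j => by
    change μ (c (Θ _)) = _
    rw [map_mul, map_pow, hΘ, hinv, hθ e g hg, T_pow, T, AddMonoidAlgebra.single_mul_single,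
      mul_one, hc]
    by_cases h : e + 1 = j
    · rw [if_pos h, if_pos (by omega)]
    · rw [if_neg h, if_neg (by omega), map_zero]
  refine ⟨((LinearMap.range (Algebra.linearMap (MvPolynomial σ k)
    (Localization.Away (X i₀ : MvPolynomial σ k)))).restrictScalars k).liftQ Λ₀ ?_,
    fun e g hg j => hΛ₀ e g hg j⟩
  rintro _ ⟨f, rfl⟩
  rw [LinearMap.mem_ker, Algebra.linearMap_apply, ← f.sum_homogeneousComponent, map_sum, map_sum]
  refine Finset.sum_eq_zero fun d _ => ?_
  have := hΛ₀ d _ (homogeneousComponent_isHomogeneous d f) 0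
  rwa [pow_zero, mul_one, if_neg (by omega)] at this

end LocalizationQuotient

/-- The homogeneous prime of the line spanned by `v`. -/
theorem exists_homogeneous_prime_of_line {k σ : Type} [Field k] (v : σ → k) :
    ∃ p : Ideal (MvPolynomial σ k), p.IsPrime ∧
      ∀ f, f ∈ p ↔ ∀ d, eval v (homogeneousComponent d f) = 0 := by
  let θ : MvPolynomial σ k →ₐ[k] Polynomial k :=
    aeval fun i => Polynomial.X * algebraMap k (Polynomial k) (v i)
  refine ⟨RingHom.ker θ, RingHom.ker_isPrime θ, fun f => ?_⟩
  have hom : ∀ d (g : MvPolynomial σ k), g.IsHomogeneous d →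
      θ g = Polynomial.X ^ d * Polynomial.C (eval v g) := fun d g hg => by
    refine (IsHomogeneous.aeval_const_mul hg _ _).trans ?_
    exact congrArg (_ * ·) (aeval_algebraMap_apply (Polynomial k) v g)
  have hcoeff : ∀ d, (θ f).coeff d = eval v (homogeneousComponent d f) := fun d => by
    conv_lhs => rw [← f.sum_homogeneousComponent, map_sum, Polynomial.finsetSum_coeff]
    rw [Finset.sum_congr rfl fun e _ => congrArg (Polynomial.coeff · d)
      (hom e _ (homogeneousComponent_isHomogeneous e f))]
    simp only [Polynomial.coeff_mul_C, Polynomial.coeff_X_pow, ite_mul, one_mul, zero_mul]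
    rw [Finset.sum_ite_eq]
    split_ifs with h
    · rfl
    · rw [homogeneousComponent_eq_zero _ _ (by simpa using h), map_zero]
  rw [RingHom.mem_ker, Polynomial.ext_iff]
  simp [hcoeff]

/-- Let `R = k[x₁,…,xₙ]` with `n ≥ 2` and `char k = 0`, and let
`M = R_{x₁}/R` be the cokernel of the localization map, with its canonical ℤ-grading
`deg` (pinned down uniquely by internality and by the degrees of the images of the
elements `x^a/x₁^j`).  Let `ρ` be the `R`-action of the graded Matlis dual `DD(M)`,
characterized by `⟨f·λ, m⟩ = ⟨λ, f·m⟩`.  Then every homogeneous prime `p ⊆ R` with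
`x₁ ∉ p` is an associated prime of `DD(M)` (the annihilator of some `λ ∈ DD(M)`),
and consequently `DD(M)` has infinitely many associated primes. -/
theorem homogeneous_primes_avoiding_x1_are_associated_primes_of_dual
    {k : Type} [Field k] [CharZero k] {n : ℕ} (hn : 2 ≤ n)
    (deg : ℤ → Submodule k
      (Localization.Away (X (⟨0, Nat.lt_of_lt_of_le Nat.zero_lt_two hn⟩ : Fin n) : MvPolynomial (Fin n) k) ⧸
        (LinearMap.range (Algebra.linearMap (MvPolynomial (Fin n) k)
          (Localization.Away (X (⟨0, Nat.lt_of_lt_of_le Nat.zero_lt_two hn⟩ : Fin n) : MvPolynomial (Fin n) k))))))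
    (hint : DirectSum.IsInternal deg)
    (hsmul : ∀ (d : ℕ) (f : MvPolynomial (Fin n) k), f.IsHomogeneous d →
      ∀ (l : ℤ), ∀ m ∈ deg l, f • m ∈ deg (l + d))
    (hmono : ∀ (a : Fin n →₀ ℕ) (j : ℕ),
      Submodule.Quotient.mk
        ((algebraMap (MvPolynomial (Fin n) k)
            (Localization.Away (X (⟨0, Nat.lt_of_lt_of_le Nat.zero_lt_two hn⟩ : Fin n) : MvPolynomial (Fin n) k))
          (monomial a 1)) *
          (IsLocalization.Away.invSelf
            (X (⟨0, Nat.lt_of_lt_of_le Nat.zero_lt_two hn⟩ : Fin n) : MvPolynomial (Fin n) k)) ^ j)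
        ∈ deg (((a.sum fun _ e => e : ℕ) : ℤ) - (j : ℤ)))
    (ρ : MvPolynomial (Fin n) k →ₐ[k] Module.End k (DDcar deg n))
    (hρ : ∀ (f : MvPolynomial (Fin n) k) (lam : DDcar deg n) m,
      gev deg hint (ρ f lam) m = gev deg hint lam (f • m)) :
    (∀ p : Ideal (MvPolynomial (Fin n) k), p.IsPrime →
      (∀ f ∈ p, ∀ d : ℕ, homogeneousComponent d f ∈ p) →
      (X (⟨0, Nat.lt_of_lt_of_le Nat.zero_lt_two hn⟩ : Fin n) : MvPolynomial (Fin n) k) ∉ p →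
      ∃ lam : DDcar deg n, ∀ f : MvPolynomial (Fin n) k, f ∈ p ↔ ρ f lam = 0) ∧
    {p : Ideal (MvPolynomial (Fin n) k) | p.IsPrime ∧
      ∃ lam : DDcar deg n, ∀ f : MvPolynomial (Fin n) k, f ∈ p ↔ ρ f lam = 0}.Infinite := by
  have exists_ann_eq : ∀ p : Ideal (MvPolynomial (Fin n) k), p.IsPrime →
      (∀ f ∈ p, ∀ d : ℕ, homogeneousComponent d f ∈ p) →
      (X (⟨0, Nat.lt_of_lt_of_le Nat.zero_lt_two hn⟩ : Fin n) : MvPolynomial (Fin n) k) ∉ p →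
      ∃ lam : DDcar deg n, ∀ f : MvPolynomial (Fin n) k, f ∈ p ↔ ρ f lam = 0 := by
    intro p hp hhom hX
    obtain ⟨φ, hφ1, hφ⟩ := exists_dehomogenization p _ hX
    obtain ⟨μ, hμ⟩ := exists_dual_comp_ne_zero φ
    obtain ⟨Λ, hΛ⟩ := exists_dual_fracClass _ φ hφ1 μ
    obtain ⟨lam, hlam⟩ := exists_gev_eq (n := n) hint (1 - n) Λ (span_fracClass_monomial _) (by
      rintro _ ⟨a, j, rfl⟩
      refine ⟨_, hmono a j, fun h => ?_⟩
      rw [hΛ _ _ (isHomogeneous_monomial 1 rfl) j, if_neg]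
      change a.sum (fun _ e => e) + 1 ≠ j
      omega)
    have hpair : ∀ (f : MvPolynomial (Fin n) k) (a : Fin n →₀ ℕ) (j : ℕ),
        Λ (f • fracClass _ (monomial a 1) j) = ∑ d ∈ Finset.range (f.totalDegree + 1),
          if d + a.degree + 1 = j then
            μ (φ (homogeneousComponent d f) * φ (monomial a 1)) else 0 := fun f a j => by
      conv_lhs => rw [← f.sum_homogeneousComponent]
      rw [smul_fracClass, Finset.sum_mul, fracClass_sum, map_sum]
      refine Finset.sum_congr rfl fun d _ => ?_
      rw [hΛ _ _ ((homogeneousComponent_isHomogeneous d f).mul (isHomogeneous_monomial 1 rfl)) j,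
        map_mul]
    have hzero : ∀ f, ρ f lam = 0 ↔ ∀ m, Λ (f • m) = 0 := fun f => by
      rw [← (gev_injective hint).eq_iff, map_zero, LinearMap.ext_iff]
      simp only [hρ, hlam, LinearMap.zero_apply]
    refine ⟨lam, fun f => ?_⟩
    rw [hzero]
    constructor
    · intro hf m
      have hs : m ∈ Submodule.span k _ := span_fracClass_monomial (k := k) _ ▸ Submodule.mem_top
      induction hs using Submodule.span_induction with
      | mem m hm =>
        obtain ⟨a, j, rfl⟩ := hm
        rw [hpair]
        refine Finset.sum_eq_zero fun d _ => ?_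
        rw [(hφ d _ (homogeneousComponent_isHomogeneous d f)).mpr (hhom f hf d)]
        simp
      | zero => simp
      | add x y _ _ hx hy => rw [smul_add, map_add, hx, hy, add_zero]
      | smul c x _ hx => rw [smul_comm, map_smul, hx, smul_zero]
    · intro h
      rw [← f.sum_homogeneousComponent]
      refine Ideal.sum_mem _ fun d hd => ?_
      by_contra hfd
      obtain ⟨a, ha⟩ := hμ _ (mt (hφ d _ (homogeneousComponent_isHomogeneous d f)).mp hfd)
      apply ha
      rw [← h (fracClass _ (monomial a 1) (d + a.degree + 1)), hpair,
        Finset.sum_eq_single_of_mem d hd fun e _ he => if_neg (by omega), if_pos rfl]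
  refine ⟨exists_ann_eq, ?_⟩
  have h01 : (⟨1, hn⟩ : Fin n) ≠ ⟨0, Nat.lt_of_lt_of_le Nat.zero_lt_two hn⟩ := by simp
  let v : k → Fin n → k := fun c => Function.update (fun _ => 1) ⟨1, hn⟩ c
  choose P hPprime hP using fun c => exists_homogeneous_prime_of_line (v c)
  have hv₀ : ∀ c, v c ⟨0, Nat.lt_of_lt_of_le Nat.zero_lt_two hn⟩ = 1 := fun c =>
    Function.update_of_ne h01.symm _ _
  have hv₁ : ∀ c, v c ⟨1, hn⟩ = c := fun c => Function.update_self _ _ _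
  refine Set.infinite_of_injective_forall_mem (f := P) (fun b c hbc => ?_) fun c =>
    ⟨hPprime c, exists_ann_eq _ (hPprime c) ?_ ?_⟩
  · let g : MvPolynomial (Fin n) k := X ⟨1, hn⟩ -
      C b * X ⟨0, Nat.lt_of_lt_of_le Nat.zero_lt_two hn⟩
    have hg : g.IsHomogeneous 1 :=
      (isHomogeneous_X k _).sub (by simpa using (isHomogeneous_C _ b).mul (isHomogeneous_X k _))
    have hmem : g ∈ P b := (hP b g).mpr fun d => by
      rw [homogeneousComponent_of_mem hg]
      split_ifs
      · simp [g, hv₀, hv₁]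
      · simp
    rw [hbc, hP] at hmem
    have := hmem 1
    rw [homogeneousComponent_eq_self hg] at this
    simp only [g, map_sub, map_mul, eval_X, eval_C, hv₀, hv₁, mul_one] at this
    exact (sub_eq_zero.mp this).symm
  · intro f hf d
    refine (hP c _).mpr fun e => ?_
    rw [homogeneousComponent_of_mem (homogeneousComponent_isHomogeneous d f)]
    split_ifs
    · exact (hP c f).mp hf d
    · simp
  · rw [hP]
    intro h
    have := h 1
    rw [homogeneousComponent_eq_self (isHomogeneous_X k _), eval_X, hv₀] at this
    exact one_ne_zero this
end
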